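/- arXiv:1712.00942 — 3 statements merged into one kernel-verified Lean document; each statement's English description precedes it below -/
import Mathlib

section
/- For any constants p ≥ 1 and τ > 0, there exists a constant C* > 0 such that for every positive integer n and every t ∈ ℝ^n, exp(τ·μ_p(τ; t) − C*·√n)·Θ_p(τ; t) ≤ N_p(ℤ^n, μ_p(τ; t)^{1/p}, t) ≤ exp(τ·μ_p(τ; t))·Θ_p(τ; t). -/
open Real BigOperators

/-- The ℓ_p "norm" (for a real exponent `p`) of a vector in `ℝ^n`. -/
noncomputable def lpNorm (p : ℝ) {n : ℕ} (x : Fin n → ℝ) : ℝ :=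
  (∑ i, |x i| ^ p) ^ (1 / p)

/-- `N_p(ℤ^n, r, t)`: the number of integer points `z ∈ ℤ^n` with `‖z - t‖_p ≤ r`. -/
noncomputable def Npt (p : ℝ) (n : ℕ) (r : ℝ) (t : Fin n → ℝ) : ℕ :=
  Nat.card {z : Fin n → ℤ | lpNorm p (fun i => (z i : ℝ) - t i) ≤ r}

/-- `Θ_p(τ; s) = ∑_{z ∈ ℤ} exp(-τ |z - s|^p)`. -/
noncomputable def Theta1 (p τ s : ℝ) : ℝ :=
  ∑' z : ℤ, Real.exp (-τ * |(z : ℝ) - s| ^ p)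

/-- `Θ_p(τ; t) = ∏_i Θ_p(τ; t_i)` for a vector `t ∈ ℝ^n`. -/
noncomputable def ThetaVec (p : ℝ) {n : ℕ} (τ : ℝ) (t : Fin n → ℝ) : ℝ :=
  ∏ i, Theta1 p τ (t i)

/-- `μ_p(τ; s) = E_{X ∼ D_p(τ;s)}[|X|^p]`, where `D_p(τ; s)` assigns to each
`x ∈ ℤ - s` probability `exp(-τ|x|^p)/Θ_p(τ; s)`. -/
noncomputable def mu1 (p τ s : ℝ) : ℝ :=
  (∑' z : ℤ, |(z : ℝ) - s| ^ p * Real.exp (-τ * |(z : ℝ) - s| ^ p)) / Theta1 p τ s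

/-- `μ_p(τ; t) = ∑_i μ_p(τ; t_i)` for a vector `t ∈ ℝ^n`. -/
noncomputable def muVec (p : ℝ) {n : ℕ} (τ : ℝ) (t : Fin n → ℝ) : ℝ :=
  ∑ i, mu1 p τ (t i)

open MeasureTheory ProbabilityTheory

lemma summable_exp_abs (b : ℝ) (hb : 0 < b) : Summable fun z : ℤ => Real.exp (-b * |(z : ℝ)|) := by
  have h : Summable fun n : ℕ => Real.exp (-b * (n : ℝ)) := by
    have := Real.summable_exp_nat_mul_iff.mpr (neg_lt_zero.mpr hb)
    refine this.congr fun n => ?_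
    rw [mul_comm]
  refine summable_int_iff_summable_nat_and_neg.mpr ⟨?_, ?_⟩
  · simpa using h
  · simpa using h

lemma rpow_ge_sub_one (p x : ℝ) (hp : 1 ≤ p) (hx : 0 ≤ x) : x - 1 ≤ x ^ p := by
  rcases le_total x 1 with h | h
  · have := Real.rpow_nonneg hx p
    linarith
  · have := Real.self_le_rpow_of_one_le h hp
    linarith

lemma weight_le (p b s : ℝ) (hp : 1 ≤ p) (hb : 0 < b) (z : ℤ) :
    Real.exp (-b * |(z : ℝ) - s| ^ p) ≤
      Real.exp (2 * b) * Real.exp (-b * |((z - round s : ℤ) : ℝ)|) := by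
  rw [← Real.exp_add]
  apply Real.exp_le_exp.mpr
  have h1 := rpow_ge_sub_one p |(z : ℝ) - s| hp (abs_nonneg _)
  have h2 : |((z - round s : ℤ) : ℝ)| ≤ |(z : ℝ) - s| + 1 / 2 := by
    have := abs_add_le ((z : ℝ) - s) (s - round s)
    have h3 := abs_sub_round s
    push_cast
    rw [show (z : ℝ) - s + (s - round s) = z - round s by ring] at this
    linarith
  nlinarith

lemma summable_shift (b s : ℝ) (hb : 0 < b) :
    Summable fun z : ℤ => Real.exp (2 * b) * Real.exp (-b * |((z - round s : ℤ) : ℝ)|) := by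
  apply Summable.mul_left
  exact (Equiv.subRight (round s)).summable_iff.mpr (summable_exp_abs b hb)

lemma summable_weight (p b s : ℝ) (hp : 1 ≤ p) (hb : 0 < b) :
    Summable fun z : ℤ => Real.exp (-b * |(z : ℝ) - s| ^ p) :=
  Summable.of_nonneg_of_le (fun z => (Real.exp_pos _).le) (weight_le p b s hp hb)
    (summable_shift b s hb)

lemma theta_le (p b s : ℝ) (hp : 1 ≤ p) (hb : 0 < b) :
    Theta1 p b s ≤ Real.exp (2 * b) * ∑' z : ℤ, Real.exp (-b * |(z : ℝ)|) := by
  unfold Theta1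
  refine ((summable_weight p b s hp hb).tsum_le_tsum (weight_le p b s hp hb)
    (summable_shift b s hb)).trans ?_
  rw [tsum_mul_left]
  have := (Equiv.subRight (round s)).tsum_eq (fun z : ℤ => Real.exp (-b * |(z : ℝ)|))
  simp only [Equiv.subRight_apply] at this
  rw [this]

lemma near_le (p s : ℝ) (hp : 1 ≤ p) (z : ℤ) :
    |((round s : ℤ) : ℝ) - s| ^ p ≤ |(z : ℝ) - s| ^ p := by
  apply Real.rpow_le_rpow (abs_nonneg _) _ (by linarith)
  rw [abs_sub_comm, abs_sub_comm (z : ℝ)]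
  exact round_le s z

lemma near_le_one (p s : ℝ) (hp : 1 ≤ p) :
    |((round s : ℤ) : ℝ) - s| ^ p ≤ 1 := by
  apply Real.rpow_le_one (abs_nonneg _) _ (by linarith)
  rw [abs_sub_comm]
  linarith [abs_sub_round s]

lemma far_point (p s : ℝ) (hp : 1 ≤ p) : ∃ z : ℤ,
    1 + |((round s : ℤ) : ℝ) - s| ^ p ≤ |(z : ℝ) - s| ^ p ∧ |(z : ℝ) - s| ^ p ≤ 2 ^ p := by
  have h0 := abs_sub_round s
  rw [abs_sub_comm] at h0
  have key : ∃ z : ℤ, |(z : ℝ) - s| = 1 + |((round s : ℤ) : ℝ) - s| := by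
    rcases le_total 0 (((round s : ℤ) : ℝ) - s) with h | h
    · refine ⟨round s + 1, ?_⟩
      push_cast
      rw [abs_of_nonneg h, abs_of_nonneg (by linarith)]
      ring
    · refine ⟨round s - 1, ?_⟩
      push_cast
      rw [abs_of_nonpos h, abs_of_nonpos (by linarith)]
      ring
  obtain ⟨z, hz⟩ := key
  refine ⟨z, ?_, ?_⟩
  · rw [hz]
    have := Real.add_rpow_le_rpow_add (p := p) zero_le_one (abs_nonneg (((round s : ℤ) : ℝ) - s)) hp
    simpa using this
  · apply Real.rpow_le_rpow (abs_nonneg _) _ (by linarith)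
    linarith

lemma sq_mul_exp_le (τ x : ℝ) (hτ : 0 < τ) (hx : 0 ≤ x) :
    x ^ 2 * Real.exp (-τ * x) ≤ 8 / τ ^ 2 * Real.exp (-(τ / 2) * x) := by
  have h := Real.quadratic_le_exp_of_nonneg (x := τ / 2 * x) (by positivity)
  have h1 : x ^ 2 ≤ 8 / τ ^ 2 * Real.exp (τ / 2 * x) := by
    rw [div_mul_eq_mul_div, le_div_iff₀ (by positivity)]
    have : 0 ≤ τ / 2 * x := by positivity
    nlinarith
  calc x ^ 2 * Real.exp (-τ * x) ≤ (8 / τ ^ 2 * Real.exp (τ / 2 * x)) * Real.exp (-τ * x) := by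
        gcongr
    _ = _ := by
        rw [mul_assoc, ← Real.exp_add]
        ring_nf

/-- The one-dimensional facts, uniform in the shift. -/
lemma one_dim (p τ : ℝ) (hp : 1 ≤ p) (hτ : 0 < τ) :
    ∃ V M c₀ c T : ℝ, 0 < V ∧ 0 < M ∧ 0 < c₀ ∧ 0 < c ∧ 1 ≤ T ∧ ∀ s : ℝ,
      0 < Theta1 p τ s ∧ Theta1 p τ s ≤ T ∧ mu1 p τ s ≤ M ∧
      c₀ ≤ mu1 p τ s - |((round s : ℤ) : ℝ) - s| ^ p ∧
      ∃ P : Measure ℤ, IsProbabilityMeasure P ∧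
        (∀ z : ℤ, P.real {z} = Real.exp (-τ * |(z : ℝ) - s| ^ p) / Theta1 p τ s) ∧
        MemLp (fun z : ℤ => |(z : ℝ) - s| ^ p) 2 P ∧
        ∫ z : ℤ, |(z : ℝ) - s| ^ p ∂P = mu1 p τ s ∧
        variance (fun z : ℤ => |(z : ℝ) - s| ^ p) P ≤ V ∧
        c ≤ P.real {round s} := by
  set T₁ := Real.exp (2 * τ) * ∑' z : ℤ, Real.exp (-τ * |(z : ℝ)|) with hT₁
  set T₂ := Real.exp (2 * (τ / 2)) * ∑' z : ℤ, Real.exp (-(τ / 2) * |(z : ℝ)|) with hT₂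
  have hT₁pos : 0 < T₁ := mul_pos (Real.exp_pos _)
    ((summable_exp_abs τ hτ).tsum_pos (fun _ => (Real.exp_pos _).le) 0 (Real.exp_pos _))
  have hT₂pos : 0 < T₂ := mul_pos (Real.exp_pos _)
    ((summable_exp_abs (τ / 2) (by linarith)).tsum_pos (fun _ => (Real.exp_pos _).le) 0
      (Real.exp_pos _))
  refine ⟨8 / τ ^ 2 * T₂ / Real.exp (-τ), 8 / τ ^ 2 * T₂ / Real.exp (-τ) + 1,
    Real.exp (-τ * 2 ^ p) / T₁, Real.exp (-τ) / T₁, T₁ + 1, by positivity, by positivity,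
    by positivity, by positivity, by linarith, ?_⟩
  intro s
  set a : ℤ → ℝ := fun z => |(z : ℝ) - s| ^ p with ha
  have ha0 : ∀ z, 0 ≤ a z := fun z => Real.rpow_nonneg (abs_nonneg _) _
  set w : ℤ → ℝ := fun z => Real.exp (-τ * a z) with hw
  have hw0 : ∀ z, 0 < w z := fun z => Real.exp_pos _
  have hsw : Summable w := summable_weight p τ s hp hτ
  have hθ : Theta1 p τ s = ∑' z, w z := rfl
  have hθlow : Real.exp (-τ) ≤ Theta1 p τ s := by
    rw [hθ]
    refine le_trans ?_ (hsw.le_tsum (round s) (fun z _ => (hw0 z).le))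
    apply Real.exp_le_exp.mpr
    have : a (round s) ≤ 1 := near_le_one p s hp
    nlinarith
  have hθpos : 0 < Theta1 p τ s := lt_of_lt_of_le (Real.exp_pos _) hθlow
  have hθle : Theta1 p τ s ≤ T₁ := theta_le p τ s hp hτ
  have hb : ∀ z, a z ^ 2 * w z ≤ 8 / τ ^ 2 * Real.exp (-(τ / 2) * a z) := fun z =>
    sq_mul_exp_le τ (a z) hτ (ha0 z)
  have hsb : Summable fun z => 8 / τ ^ 2 * Real.exp (-(τ / 2) * a z) :=
    (summable_weight p (τ / 2) s hp (by linarith)).mul_left _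
  have hs2 : Summable fun z => a z ^ 2 * w z :=
    Summable.of_nonneg_of_le (fun z => mul_nonneg (sq_nonneg _) (hw0 z).le) hb hsb
  have hs1 : Summable fun z => a z * w z := by
    refine Summable.of_nonneg_of_le (fun z => mul_nonneg (ha0 z) (hw0 z).le) (fun z => ?_)
      (hs2.add hsw)
    have := hw0 z
    nlinarith [sq_nonneg (a z - 1), ha0 z]
  have hm2 : ∑' z, a z ^ 2 * w z ≤ 8 / τ ^ 2 * T₂ := by
    refine (hs2.tsum_le_tsum hb hsb).trans ?_
    rw [tsum_mul_left]
    have := theta_le p (τ / 2) s hp (by linarith)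
    unfold Theta1 at this
    gcongr
  have hm2' : (∑' z, a z ^ 2 * w z) / Theta1 p τ s ≤ 8 / τ ^ 2 * T₂ / Real.exp (-τ) := by
    gcongr
  have hmu : mu1 p τ s = (∑' z, a z * w z) / Theta1 p τ s := rfl
  refine ⟨hθpos, by linarith, ?_, ?_, ?_⟩
  · have : (∑' z, a z * w z) ≤ (∑' z, a z ^ 2 * w z) + Theta1 p τ s := by
      rw [hθ, ← hs2.tsum_add hsw]
      refine hs1.tsum_le_tsum (fun z => ?_) (hs2.add hsw)
      have := hw0 z
      nlinarith [sq_nonneg (a z - 1), ha0 z]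
    rw [hmu]
    calc _ ≤ ((∑' z, a z ^ 2 * w z) + Theta1 p τ s) / Theta1 p τ s := by gcongr
      _ = (∑' z, a z ^ 2 * w z) / Theta1 p τ s + 1 := by field_simp
      _ ≤ _ := by linarith
  · obtain ⟨z₁, h1, h2⟩ := far_point p s hp
    set d := |((round s : ℤ) : ℝ) - s| ^ p with hd
    have hdz : ∀ z, d ≤ a z := near_le p s hp
    have hsd : Summable fun z => (a z - d) * w z := by
      simp only [sub_mul]
      exact hs1.sub (hsw.mul_left d)
    have e : mu1 p τ s - d = (∑' z, (a z - d) * w z) / Theta1 p τ s := by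
      have : ∑' z, (a z - d) * w z = (∑' z, a z * w z) - d * Theta1 p τ s := by
        simp only [sub_mul]
        rw [hs1.tsum_sub (hsw.mul_left d), tsum_mul_left, hθ]
      rw [this, hmu]
      field_simp
    rw [e]
    have hl := hsd.le_tsum z₁ (fun z _ => mul_nonneg (sub_nonneg.mpr (hdz z)) (hw0 z).le)
    have hw1 : Real.exp (-τ * 2 ^ p) ≤ w z₁ := by
      apply Real.exp_le_exp.mpr
      have : a z₁ ≤ 2 ^ p := h2
      nlinarith
    have : Real.exp (-τ * 2 ^ p) ≤ ∑' z, (a z - d) * w z := by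
      have h1' : 1 ≤ a z₁ - d := by
        have : 1 + d ≤ a z₁ := h1
        linarith
      nlinarith [hw0 z₁]
    exact div_le_div₀ ((Real.exp_pos _).le.trans this) this hθpos hθle
  · set q : ℤ → ENNReal := fun z => ENNReal.ofReal (w z / Theta1 p τ s) with hq
    have hqr : ∀ z, (q z).toReal = w z / Theta1 p τ s := fun z =>
      ENNReal.toReal_ofReal (div_nonneg (hw0 z).le hθpos.le)
    have hqt : ∀ z, q z ≠ ⊤ := fun z => ENNReal.ofReal_ne_top
    set P : Measure ℤ := Measure.sum (fun z : ℤ => q z • Measure.dirac z) with hP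
    have hPs : ∀ z : ℤ, P.real {z} = w z / Theta1 p τ s := fun z => by
      rw [measureReal_def, hP, Measure.sum_smul_dirac_singleton, hqr]
    have hprob : IsProbabilityMeasure P := by
      constructor
      rw [hP, Measure.sum_apply _ MeasurableSet.univ]
      simp only [Measure.smul_apply, measure_univ, smul_eq_mul, mul_one]
      rw [hq, ← ENNReal.ofReal_tsum_of_nonneg (fun z => div_nonneg (hw0 z).le hθpos.le)
        (hsw.div_const _), tsum_div_const, ← hθ, div_self hθpos.ne', ENNReal.ofReal_one]
    have hint2 : Integrable (fun z => a z ^ 2) P := by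
      refine integrable_sum_dirac hqt ?_
      refine (hs2.div_const (Theta1 p τ s)).congr fun z => ?_
      rw [hqr, Real.norm_of_nonneg (sq_nonneg _)]
      ring
    have hmem : MemLp a 2 P :=
      (memLp_two_iff_integrable_sq (measurable_of_countable _).aestronglyMeasurable).mpr hint2
    refine ⟨P, hprob, hPs, hmem, ?_, ?_, ?_⟩
    · rw [hP, integral_sum_dirac hqt, hmu, ← tsum_div_const]
      refine tsum_congr fun z => ?_
      rw [hqr, smul_eq_mul]
      ring
    · refine (variance_le_expectation_sq (measurable_of_countable _).aestronglyMeasurable).trans ?_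
      refine le_trans (le_of_eq ?_) hm2'
      have : ∫ z, (a ^ 2) z ∂P = ∫ z, a z ^ 2 ∂P := rfl
      rw [this, hP, integral_sum_dirac hqt, ← tsum_div_const]
      refine tsum_congr fun z => ?_
      rw [hqr, smul_eq_mul]
      ring
    · rw [hPs]
      have : Real.exp (-τ) ≤ w (round s) := by
        apply Real.exp_le_exp.mpr
        have : a (round s) ≤ 1 := near_le_one p s hp
        nlinarith
      exact div_le_div₀ (hw0 _).le this hθpos hθle

lemma pi_real_finset {n : ℕ} (Q : Fin n → Measure ℤ) [∀ i, IsProbabilityMeasure (Q i)]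
    (A : Finset (Fin n → ℤ)) :
    (Measure.pi Q).real (A : Set (Fin n → ℤ)) = ∑ z ∈ A, ∏ i, (Q i).real {z i} := by
  rw [← sum_measureReal_singleton]
  refine Finset.sum_congr rfl fun z _ => ?_
  rw [measureReal_def, Measure.pi_singleton, ENNReal.toReal_prod]
  rfl

lemma cheb {n : ℕ} (Q : Fin n → Measure ℤ) [∀ i, IsProbabilityMeasure (Q i)]
    (f : Fin n → ℤ → ℝ) (hf : ∀ i, MemLp (f i) 2 (Q i)) (V L : ℝ)
    (hV : ∀ i, variance (f i) (Q i) ≤ V) (hL : 0 < L) (hL2 : 2 * (n * V) ≤ L ^ 2) :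
    1 / 2 ≤ (Measure.pi Q).real
      {z : Fin n → ℤ | |∑ i, f i (z i) - ∑ i, ∫ x, f i x ∂(Q i)| < L} := by
  have hfi : ∀ i, MemLp (fun z : Fin n → ℤ => f i (z i)) 2 (Measure.pi Q) := fun i =>
    (hf i).comp_measurePreserving (measurePreserving_eval Q i)
  have hmem : MemLp (∑ i, fun z : Fin n → ℤ => f i (z i)) 2 (Measure.pi Q) :=
    memLp_finsetSum' _ fun i _ => hfi i
  have hvar : variance (∑ i, fun z : Fin n → ℤ => f i (z i)) (Measure.pi Q) ≤ n * V := by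
    rw [variance_sum_pi hf]
    refine (Finset.sum_le_sum fun i _ => hV i).trans ?_
    simp
  have hmean : ∫ z, (∑ i, fun z : Fin n → ℤ => f i (z i)) z ∂(Measure.pi Q)
      = ∑ i, ∫ x, f i x ∂(Q i) := by
    simp only [Finset.sum_apply]
    rw [integral_finsetSum _ fun i _ => (hfi i).integrable (by norm_num)]
    refine Finset.sum_congr rfl fun i _ => ?_
    exact integral_comp_eval (hf i).aestronglyMeasurable
  have h := meas_ge_le_variance_div_sq hmem hL
  rw [hmean] at h
  simp only [Finset.sum_apply] at h
  have h' : (Measure.pi Q).real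
      {z : Fin n → ℤ | L ≤ |∑ i, f i (z i) - ∑ i, ∫ x, f i x ∂(Q i)|} ≤ 1 / 2 := by
    refine (ENNReal.toReal_le_of_le_ofReal (by have := variance_nonneg (∑ i, fun z : Fin n → ℤ => f i (z i)) (Measure.pi Q); positivity) h).trans ?_
    rw [div_le_iff₀ (by positivity)]
    linarith
  have hc : {z : Fin n → ℤ | |∑ i, f i (z i) - ∑ i, ∫ x, f i x ∂(Q i)| < L} =
      {z : Fin n → ℤ | L ≤ |∑ i, f i (z i) - ∑ i, ∫ x, f i x ∂(Q i)|}ᶜ := by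
    ext z
    simp
  rw [hc, measureReal_compl (Set.to_countable _).measurableSet, probReal_univ]
  linarith

lemma ball_finite {n : ℕ} (p R : ℝ) (hp : 1 ≤ p) (t : Fin n → ℝ) :
    {z : Fin n → ℤ | ∑ i, |(z i : ℝ) - t i| ^ p ≤ R}.Finite := by
  refine Set.Finite.subset (Set.Finite.pi' (t := fun i : Fin n =>
    Set.Icc ⌈t i - (R + 1)⌉ ⌊t i + (R + 1)⌋) fun i => Set.finite_Icc _ _) ?_
  intro z hz i
  have h1 : |(z i : ℝ) - t i| ^ p ≤ R :=
    (Finset.single_le_sum (f := fun i => |(z i : ℝ) - t i| ^ p)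
      (fun j _ => Real.rpow_nonneg (abs_nonneg _) _) (Finset.mem_univ i)).trans hz
  have h2 := rpow_ge_sub_one p _ hp (abs_nonneg ((z i : ℝ) - t i))
  have h3 := abs_le.mp (show |(z i : ℝ) - t i| ≤ R + 1 by linarith)
  exact ⟨Int.ceil_le.mpr (by linarith [h3.1]), Int.le_floor.mpr (by linarith [h3.2])⟩

lemma sum_first {n k : ℕ} (hk : k ≤ n) (x : ℝ) :
    ∑ i : Fin n, (if i.val < k then x else 0) = k * x := by
  rw [Fin.sum_univ_eq_sum_range (fun i => if i < k then x else 0) n, ← Finset.sum_filter]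
  have : (Finset.range n).filter (fun i => i < k) = Finset.range k := by
    ext i
    simp
    omega
  rw [this]
  simp

lemma prod_weight {n : ℕ} (p τ : ℝ) (t : Fin n → ℝ) (z : Fin n → ℤ) :
    ∏ i, (Real.exp (-τ * |(z i : ℝ) - t i| ^ p) / Theta1 p τ (t i)) =
      Real.exp (-τ * ∑ i, |(z i : ℝ) - t i| ^ p) / ThetaVec p τ t := by
  rw [Finset.prod_div_distrib, ← Real.exp_sum, ← Finset.mul_sum]
  rfl

/-- For any constants `p ≥ 1` and `τ > 0`, there is a constant `C* > 0` such that for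
every positive integer `n` and every `t ∈ ℝ^n`,
`exp(τ μ_p(τ;t) - C*√n) Θ_p(τ;t) ≤ N_p(ℤ^n, μ_p(τ;t)^{1/p}, t) ≤ exp(τ μ_p(τ;t)) Θ_p(τ;t)`. -/
theorem theta_gives_good_approx (p τ : ℝ) (hp : 1 ≤ p) (hτ : 0 < τ) :
    ∃ Cstar : ℝ, 0 < Cstar ∧ ∀ (n : ℕ), 0 < n → ∀ t : Fin n → ℝ,
      Real.exp (τ * muVec p τ t - Cstar * Real.sqrt n) * ThetaVec p τ t ≤
        (Npt p n ((muVec p τ t) ^ (1 / p)) t : ℝ) ∧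
      (Npt p n ((muVec p τ t) ^ (1 / p)) t : ℝ) ≤
        Real.exp (τ * muVec p τ t) * ThetaVec p τ t := by
  obtain ⟨V, M, c₀, c, T, hV, hM, hc₀, hc, hT, H⟩ := one_dim p τ hp hτ
  set l := |Real.log c| with hl
  have hl0 : 0 ≤ l := abs_nonneg _
  have hcl : Real.exp (-l) ≤ c := by
    rw [← Real.le_log_iff_exp_le hc]
    exact neg_abs_le _
  set K := √(2 * V) / c₀ + 1 with hK
  have hK0 : 0 < K := by positivity
  have hlT : 0 ≤ Real.log T := Real.log_nonneg hT
  have hl2 : 0 < Real.log 2 := Real.log_pos (by norm_num)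
  refine ⟨K * (τ * M + l + Real.log T) + τ * √(2 * V) + Real.log 2, by positivity, ?_⟩
  intro n hn t
  have hn1 : (1 : ℝ) ≤ n := by exact_mod_cast hn
  have hsn : 1 ≤ √(n : ℝ) := Real.one_le_sqrt.mpr hn1
  choose hθ hθT hμM hgap P hP hPs hmem hmean hvar hround using fun i => H (t i)
  have e0 : ∀ (i : Fin n) (z : ℤ), 0 ≤ |(z : ℝ) - t i| ^ p := fun i z =>
    Real.rpow_nonneg (abs_nonneg _) _
  have hμ0 : 0 ≤ muVec p τ t := Finset.sum_nonneg fun i _ => by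
    linarith [hgap i, e0 i (round (t i))]
  have hΘ : 0 < ThetaVec p τ t := Finset.prod_pos fun i _ => hθ i
  set S : (Fin n → ℤ) → ℝ := fun z => ∑ i, |(z i : ℝ) - t i| ^ p with hS
  have hfin : {z | S z ≤ muVec p τ t}.Finite := ball_finite p _ hp t
  have hset : {z : Fin n → ℤ | _root_.lpNorm p (fun i => (z i : ℝ) - t i) ≤ (muVec p τ t) ^ (1 / p)} =
      {z | S z ≤ muVec p τ t} := by
    ext z
    simp only [Set.mem_ofPred_eq, _root_.lpNorm]
    exact Real.rpow_le_rpow_iff (Finset.sum_nonneg fun i _ => e0 i (z i)) hμ0 (by positivity)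
  set B := hfin.toFinset with hB
  have hN : (Npt p n ((muVec p τ t) ^ (1 / p)) t : ℝ) = B.card := by
    unfold Npt
    rw [hset, Nat.card_coe_set_eq, Set.ncard_eq_toFinset_card _ hfin]
  have hmB : ∀ z, z ∈ B ↔ S z ≤ muVec p τ t := fun z => by simp [hB]
  rw [hN]
  constructor
  · set k := ⌈√(2 * V) * √(n : ℝ) / c₀⌉₊ with hk
    have hk1 : √(2 * V) * √(n : ℝ) / c₀ ≤ k := Nat.le_ceil _
    have hk2 : (k : ℝ) ≤ K * √(n : ℝ) := by
      have := (Nat.ceil_lt_add_one (show 0 ≤ √(2 * V) * √(n : ℝ) / c₀ by positivity)).le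
      calc (k : ℝ) ≤ √(2 * V) * √(n : ℝ) / c₀ + 1 := this
        _ ≤ √(2 * V) * √(n : ℝ) / c₀ + √(n : ℝ) := by linarith
        _ = K * √(n : ℝ) := by rw [hK]; ring
    rcases lt_or_ge n k with hnk | hkn
    · have hnk' : (n : ℝ) ≤ K * √(n : ℝ) := le_trans (by exact_mod_cast hnk.le) hk2
      have hone : (1 : ℝ) ≤ B.card := by
        have : (fun i => round (t i)) ∈ B := by
          rw [hmB]
          exact Finset.sum_le_sum fun i _ => by linarith [hgap i]
        exact_mod_cast Finset.card_pos.mpr ⟨_, this⟩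
      refine le_trans ?_ hone
      have h1 : muVec p τ t ≤ n * M := by
        refine (Finset.sum_le_sum fun i _ => hμM i).trans ?_
        simp
      have h2 : ThetaVec p τ t ≤ Real.exp (n * Real.log T) := by
        refine (Finset.prod_le_prod (fun i _ => (hθ i).le) fun i _ => hθT i).trans ?_
        rw [Real.exp_nat_mul, Real.exp_log (by linarith)]
        simp
      calc _ ≤ Real.exp (τ * muVec p τ t -
              (K * (τ * M + l + Real.log T) + τ * √(2 * V) + Real.log 2) * √(n : ℝ)) *
              Real.exp (n * Real.log T) := by gcongr
        _ ≤ 1 := by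
          rw [← Real.exp_add]
          apply Real.exp_le_one_iff.mpr
          have a1 : τ * muVec p τ t ≤ τ * (n * M) := by gcongr
          have a2 : n * (τ * M + Real.log T) ≤ K * √(n : ℝ) * (τ * M + Real.log T) := by gcongr
          have a3 : 0 ≤ (K * l + τ * √(2 * V) + Real.log 2) * √(n : ℝ) := by positivity
          linarith
    · set L := √(2 * V) * √(n : ℝ) with hL
      have hLpos : 0 < L := by positivity
      have hL2 : 2 * (n * V) ≤ L ^ 2 := by
        rw [hL, mul_pow, Real.sq_sqrt (by positivity), Real.sq_sqrt (by positivity)]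
        linarith
      set Q : Fin n → Measure ℤ := fun i =>
        if i.val < k then Measure.dirac (round (t i)) else P i with hQ
      have hQp : ∀ i, IsProbabilityMeasure (Q i) := fun i => by
        simp only [hQ]
        split_ifs
        · infer_instance
        · exact hP i
      set f : Fin n → ℤ → ℝ := fun i z => |(z : ℝ) - t i| ^ p with hf
      have hQm : ∀ i, MemLp (f i) 2 (Q i) := fun i => by
        simp only [hQ]
        split_ifs
        · have : f i =ᵐ[Measure.dirac (round (t i))] fun _ => f i (round (t i)) := by
            simp [Filter.EventuallyEq, ae_dirac_eq]
          exact (memLp_congr_ae this).mpr (memLp_const _)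
        · exact hmem i
      have hQv : ∀ i, variance (f i) (Q i) ≤ V := fun i => by
        simp only [hQ]
        split_ifs
        · rw [variance_dirac]
          exact hV.le
        · exact hvar i
      have hQe : ∀ i, ∫ x, f i x ∂(Q i) =
          if i.val < k then f i (round (t i)) else mu1 p τ (t i) := fun i => by
        simp only [hQ]
        split_ifs
        · rw [integral_dirac]
        · exact hmean i
      have hch := cheb Q f hQm V L hQv hLpos hL2
      set m := ∑ i, ∫ x, f i x ∂(Q i) with hm
      have hm1 : m ≤ muVec p τ t - k * c₀ := by
        rw [← sum_first hkn c₀, hm, muVec, ← Finset.sum_sub_distrib]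
        refine Finset.sum_le_sum fun i _ => ?_
        rw [hQe]
        split_ifs
        · have := hgap i
          simp only [hf]
          linarith
        · linarith
      have hm2 : muVec p τ t - k * M ≤ m := by
        rw [← sum_first hkn M, hm, muVec, ← Finset.sum_sub_distrib]
        refine Finset.sum_le_sum fun i _ => ?_
        rw [hQe]
        split_ifs
        · have := hμM i
          have := e0 i (round (t i))
          simp only [hf]
          linarith
        · linarith
      have hkc : L ≤ k * c₀ := (div_le_iff₀ hc₀).mp hk1
      have hAB : {z : Fin n → ℤ | |∑ i, f i (z i) - m| < L} ⊆ {z | S z ≤ muVec p τ t} := by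
        intro z hz
        have h1 : |S z - m| < L := hz
        have := (abs_lt.mp h1).2
        simp only [Set.mem_ofPred_eq]
        linarith
      have hAfin := hfin.subset hAB
      set A := hAfin.toFinset with hA
      have hAcard : A.card ≤ B.card :=
        Finset.card_le_card (Set.Finite.toFinset_subset_toFinset.mpr hAB)
      rw [← hAfin.coe_toFinset, pi_real_finset] at hch
      have hterm : ∀ z ∈ A, ∏ i, (Q i).real {z i} ≤
          Real.exp (k * l) * (Real.exp (-τ * (m - L)) / ThetaVec p τ t) := by
        intro z hz
        have hz' : |S z - m| < L := by simpa [hA] using hz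
        have hz2 := (abs_lt.mp hz').1
        have step : ∏ i, (Q i).real {z i} ≤ ∏ i, (Real.exp (if i.val < k then l else 0) *
            (Real.exp (-τ * |(z i : ℝ) - t i| ^ p) / Theta1 p τ (t i))) := by
          refine Finset.prod_le_prod (fun i _ => measureReal_nonneg) fun i _ => ?_
          rw [← hPs]
          simp only [hQ]
          split_ifs
          · by_cases hzi : z i = round (t i)
            · rw [hzi]
              have h1 : (Measure.dirac (round (t i))).real {round (t i)} ≤ 1 := measureReal_le_one
              have h2 : Real.exp (-l) ≤ (P i).real {round (t i)} := hcl.trans (hround i)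
              have h3 : Real.exp l * Real.exp (-l) = 1 := by rw [← Real.exp_add]; simp
              have h4 := mul_le_mul_of_nonneg_left h2 (Real.exp_pos l).le
              linarith
            · have : (Measure.dirac (round (t i))).real {z i} = 0 := by
                rw [measureReal_def, Measure.dirac_apply' _ (measurableSet_singleton _)]
                simp [Set.indicator, Ne.symm hzi]
              rw [this]
              positivity
          · simp
        refine step.trans ?_
        rw [Finset.prod_mul_distrib, prod_weight, ← Real.exp_sum, sum_first hkn]
        have : -τ * S z ≤ -τ * (m - L) := by nlinarith
        gcongr
      have htot := hch.trans (Finset.sum_le_card_nsmul _ _ _ hterm)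
      rw [nsmul_eq_mul] at htot
      have hB2 : 1 / 2 ≤ (B.card : ℝ) *
          (Real.exp (k * l) * (Real.exp (-τ * (m - L)) / ThetaVec p τ t)) := by
        refine htot.trans ?_
        have : (A.card : ℝ) ≤ B.card := by exact_mod_cast hAcard
        gcongr
      have hB3 : Real.exp (-(Real.log 2) - k * l + τ * (m - L)) * ThetaVec p τ t ≤ B.card := by
        have e1 : Real.exp (-(Real.log 2) - k * l + τ * (m - L)) =
            1 / 2 * (Real.exp (k * l) * Real.exp (-τ * (m - L)))⁻¹ := by
          rw [← Real.exp_add, ← Real.exp_neg, show (1 : ℝ) / 2 = Real.exp (-(Real.log 2)) by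
            rw [Real.exp_neg, Real.exp_log (by norm_num)]; norm_num, ← Real.exp_add]
          ring_nf
        rw [e1]
        calc _ ≤ ((B.card : ℝ) *
              (Real.exp (k * l) * (Real.exp (-τ * (m - L)) / ThetaVec p τ t))) *
              (Real.exp (k * l) * Real.exp (-τ * (m - L)))⁻¹ * ThetaVec p τ t := by gcongr
          _ = B.card := by field_simp
      refine le_trans ?_ hB3
      gcongr
      have a1 : τ * (muVec p τ t - k * M) ≤ τ * m := by gcongr
      have a2 : k * (τ * M + l) ≤ K * √(n : ℝ) * (τ * M + l) := by gcongr
      have a3 : 0 ≤ K * Real.log T * √(n : ℝ) := by positivity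
      have a4 : Real.log 2 * 1 ≤ Real.log 2 * √(n : ℝ) := by gcongr
      rw [hL]
      linarith
  · have h1 : (Measure.pi P).real (B : Set (Fin n → ℤ)) ≤ 1 := measureReal_le_one
    rw [pi_real_finset] at h1
    have h2 : B.card • (Real.exp (-τ * muVec p τ t) / ThetaVec p τ t) ≤
        ∑ z ∈ B, ∏ i, (P i).real {z i} := by
      refine Finset.card_nsmul_le_sum _ _ _ fun z hz => ?_
      simp only [hPs]
      rw [prod_weight]
      have hz' : S z ≤ muVec p τ t := (hmB z).mp hz
      have : -τ * muVec p τ t ≤ -τ * S z := by nlinarith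
      gcongr
    have h3 := h2.trans h1
    rw [nsmul_eq_mul, ← mul_div_assoc, div_le_one hΘ, neg_mul, Real.exp_neg,
      ← div_eq_mul_inv, div_le_iff₀ (Real.exp_pos _)] at h3
    linarith
end

section
/- For any ε, δ ∈ (0, 1/100) with ε ≤ √δ/10, any integer n ≥ 100, and any vector v ∈ ℝ^n with 1 ≤ ‖v‖₂² ≤ 1 + δ, if t ∈ ℝ^n is a uniformly random vector of Euclidean norm √δ (i.e., distributed according to the rotation-invariant probability measure on the sphere of radius √δ), then Pr[‖v − t‖₂² ≤ 1 − ε] ≥ (ε / (2√(δ(1+δ)))) · ((1 − 2ε − ε²/δ)/(1+δ))^{n/2}. -/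
open Real MeasureTheory

/-- A unit ball cap contains a cylinder. -/
lemma slab_le (m : ℕ) (a b β : ℝ) (ha : 0 ≤ a) (hβ : 0 ≤ β) (hb : b ^ 2 + β ≤ 1) :
    ENNReal.ofReal (b - a) * volume (Metric.closedBall (0 : EuclideanSpace ℝ (Fin m)) (√β)) ≤
      volume (Metric.closedBall (0 : EuclideanSpace ℝ (Fin (m + 1))) 1 ∩ {x | a ≤ x 0}) := by
  have h1 := PiLp.volume_preserving_ofLp (Fin (m + 1))
  have h2 := volume_preserving_piFinSuccAbove (fun _ : Fin (m + 1) => ℝ) 0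
  have h3 := h2.comp h1
  have h4 := PiLp.volume_preserving_toLp (Fin m)
  have hm : MeasurableSet ((WithLp.toLp 2) ⁻¹'
      (Metric.closedBall (0 : EuclideanSpace ℝ (Fin m)) (√β)) : Set (Fin m → ℝ)) :=
    h4.measurable Metric.isClosed_closedBall.measurableSet
  rw [← h4.measure_preimage Metric.isClosed_closedBall.measurableSet.nullMeasurableSet,
    ← Real.volume_Icc, ← Measure.prod_prod, ← Measure.volume_eq_prod,
    ← h3.measure_preimage (measurableSet_Icc.prod hm).nullMeasurableSet]
  apply measure_mono
  rintro x hx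
  simp only [Set.mem_preimage, Function.comp_apply, Set.mem_prod, Set.mem_Icc,
    MeasurableEquiv.piFinSuccAbove_apply, Fin.insertNthEquiv_symm_apply] at hx
  obtain ⟨⟨hx1, hx2⟩, hx3⟩ := hx
  refine ⟨?_, hx1⟩
  rw [mem_closedBall_zero_iff] at hx3 ⊢
  have h5 := pow_le_pow_left₀ (norm_nonneg _) hx3 2
  rw [Real.sq_sqrt hβ, EuclideanSpace.real_norm_sq_eq] at h5
  have h6 := EuclideanSpace.real_norm_sq_eq x
  rw [Fin.sum_univ_succ] at h6
  simp only [Fin.removeNth, Fin.zero_succAbove] at h5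
  have h7 : x 0 ^ 2 ≤ b ^ 2 := pow_le_pow_left₀ (ha.trans hx1) hx2 2
  have : ‖x‖ ^ 2 ≤ 1 := by linarith
  nlinarith [norm_nonneg x]

/-- Volumes of unit balls decrease with the dimension. -/
lemma ball_const_le (m : ℕ) (hm : 10 ≤ m) :
    √π ^ (m + 1) / Gamma (((m + 1 : ℕ) : ℝ) / 2 + 1) ≤ √π ^ m / Gamma ((m : ℝ) / 2 + 1) := by
  have hm' : (10 : ℝ) ≤ m := by exact_mod_cast hm
  set y : ℝ := ((m : ℝ) + 1) / 2 with hy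
  have hy0 : 0 < y := by positivity
  have hG : 0 < Gamma y := Gamma_pos_of_pos hy0
  have hG1 : 0 < Gamma (y + 1) := Gamma_pos_of_pos (by positivity)
  have hG2 : 0 < Gamma ((m : ℝ) / 2 + 1) := Gamma_pos_of_pos (by positivity)
  have h := Real.Gamma_mul_add_mul_le_rpow_Gamma_mul_rpow_Gamma hy0 (by positivity : 0 < y + 1)
    (by norm_num : (0 : ℝ) < 1 / 2) (by norm_num : (0 : ℝ) < 1 / 2) (by norm_num)
  have e1 : 1 / 2 * y + 1 / 2 * (y + 1) = (m : ℝ) / 2 + 1 := by rw [hy]; ring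
  rw [e1, ← Real.sqrt_eq_rpow, ← Real.sqrt_eq_rpow, ← Real.sqrt_mul hG.le] at h
  have h2 : Gamma ((m : ℝ) / 2 + 1) ^ 2 ≤ Gamma y * Gamma (y + 1) := by
    calc _ ≤ _ := pow_le_pow_left₀ hG2.le h 2
      _ = _ := Real.sq_sqrt (by positivity)
  have e2 : Gamma (y + 1) = y * Gamma y := Gamma_add_one hy0.ne'
  have h3 : (√π * Gamma ((m : ℝ) / 2 + 1)) ^ 2 ≤ Gamma (y + 1) ^ 2 := by
    rw [mul_pow, Real.sq_sqrt Real.pi_pos.le]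
    have hπ : π ≤ y := by rw [hy]; linarith [Real.pi_lt_four]
    calc π * Gamma ((m : ℝ) / 2 + 1) ^ 2 ≤ y * (Gamma y * Gamma (y + 1)) := by gcongr
      _ = _ := by rw [e2]; ring
  have h4 : √π * Gamma ((m : ℝ) / 2 + 1) ≤ Gamma (y + 1) :=
    le_of_sq_le_sq h3 hG1.le
  have e3 : ((m + 1 : ℕ) : ℝ) / 2 + 1 = y + 1 := by rw [hy]; push_cast; ring
  rw [e3, div_le_div_iff₀ hG1 hG2, pow_succ, mul_assoc]
  gcongr

/-- Double counting for a rotation invariant measure on a sphere. -/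
lemma double_count (n : ℕ) (s r : ℝ) (L : ENNReal)
    (v e : EuclideanSpace ℝ (Fin n)) (hv : v ≠ 0) (he : ‖e‖ = r)
    (μ : Measure (EuclideanSpace ℝ (Fin n))) [IsProbabilityMeasure μ] [NeZero n]
    (hsphere : μ (Metric.sphere (0 : EuclideanSpace ℝ (Fin n)) r) = 1)
    (hinv : ∀ g : EuclideanSpace ℝ (Fin n) ≃ₗᵢ[ℝ] EuclideanSpace ℝ (Fin n),
      μ.map g = μ)
    (hL : L ≤ volume (Metric.closedBall (0 : EuclideanSpace ℝ (Fin n)) 1 ∩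
      {x | s * ‖x‖ ≤ inner ℝ x e})) :
    L ≤ μ {t | s * ‖v‖ ≤ inner ℝ v t} *
      volume (Metric.closedBall (0 : EuclideanSpace ℝ (Fin n)) 1) := by
  let E := EuclideanSpace ℝ (Fin n)
  set ν : Measure E := volume.restrict (Metric.closedBall (0 : E) 1) with hν
  have : IsFiniteMeasure ν := ⟨by
    rw [hν, Measure.restrict_apply_univ]
    exact measure_closedBall_lt_top⟩
  let S : Set (E × E) := {p | s * ‖p.1‖ ≤ inner ℝ p.1 p.2}
  have hS : MeasurableSet S :=
    (isClosed_le (by fun_prop) (by fun_prop)).measurableSet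
  have hone (t : E) : MeasurableSet {x : E | s * ‖x‖ ≤ inner ℝ x t} :=
    (isClosed_le (by fun_prop) (by fun_prop)).measurableSet
  have htwo (x : E) : MeasurableSet {t : E | s * ‖x‖ ≤ inner ℝ x t} :=
    (isClosed_le (by fun_prop) (by fun_prop)).measurableSet
  have hA : ∀ᵐ t ∂μ, L ≤ ν ((fun x => (x, t)) ⁻¹' S) := by
    have : ∀ᵐ t ∂μ, t ∈ Metric.sphere (0 : E) r :=
      (prob_compl_eq_zero_iff Metric.isClosed_sphere.measurableSet).2 hsphere
    filter_upwards [this] with t ht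
    rw [mem_sphere_zero_iff_norm] at ht
    let g := Submodule.reflection (ℝ ∙ (e - t))ᗮ
    have hg : g e = t := Submodule.reflection_sub (he.trans ht.symm)
    have hgm : MeasurePreserving g := g.measurePreserving
    refine hL.trans (le_of_eq ?_)
    change _ = ν {x : E | s * ‖x‖ ≤ inner ℝ x t}
    rw [hν, Measure.restrict_apply (hone t), ← hgm.measure_preimage
      ((hone t).inter Metric.isClosed_closedBall.measurableSet).nullMeasurableSet]
    congr 1
    ext x
    have hx1 : (inner ℝ (g x) t : ℝ) = inner ℝ x e := by rw [← hg, g.inner_map_map]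
    change (x ∈ Metric.closedBall 0 1 ∧ s * ‖x‖ ≤ inner ℝ x e) ↔
      (s * ‖g x‖ ≤ inner ℝ (g x) t ∧ g x ∈ Metric.closedBall 0 1)
    rw [mem_closedBall_zero_iff, mem_closedBall_zero_iff, g.norm_map, hx1, and_comm]
  have hB : ∀ᵐ x ∂ν, μ (Prod.mk x ⁻¹' S) = μ {t | s * ‖v‖ ≤ inner ℝ v t} := by
    apply ae_restrict_of_ae
    have : ∀ᵐ x : E, x ≠ 0 := by
      rw [ae_iff]; simp
    filter_upwards [this] with x hx
    let g := Submodule.reflection (ℝ ∙ (‖v‖ • x - ‖x‖ • v))ᗮ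
    have hg : g (‖v‖ • x) = ‖x‖ • v := Submodule.reflection_sub (by
      rw [norm_smul, norm_smul, norm_norm, norm_norm, mul_comm])
    rw [← hinv g, Measure.map_apply g.continuous.measurable (htwo v), hinv g]
    congr 1
    ext t
    change s * ‖x‖ ≤ inner ℝ x t ↔ s * ‖v‖ ≤ inner ℝ v (g t)
    have hx0 : 0 < ‖x‖ := norm_pos_iff.2 hx
    have hv0 : 0 < ‖v‖ := norm_pos_iff.2 hv
    have h1 : ‖x‖ * inner ℝ v (g t) = ‖v‖ * inner ℝ x t := by
      rw [← real_inner_smul_left, ← hg, g.inner_map_map, real_inner_smul_left]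
    rw [← mul_le_mul_iff_right₀ hv0, ← h1, ← mul_le_mul_iff_right₀ (b := s * ‖v‖) hx0]
    ring_nf
  calc L = ∫⁻ t, L ∂μ := by simp
    _ ≤ ∫⁻ t, ν ((fun x => (x, t)) ⁻¹' S) ∂μ := lintegral_mono_ae hA
    _ = (ν.prod μ) S := (Measure.prod_apply_symm hS).symm
    _ = ∫⁻ x, μ (Prod.mk x ⁻¹' S) ∂ν := Measure.prod_apply hS
    _ = ∫⁻ x, μ {t | s * ‖v‖ ≤ inner ℝ v t} ∂ν := lintegral_congr_ae hB
    _ = _ := by rw [lintegral_const, hν, Measure.restrict_apply_univ]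

/-- For `ε, δ ∈ (0, 1/100)` with `ε ≤ √δ/10`, `n ≥ 100`, and `v ∈ ℝ^n` with
`1 ≤ ‖v‖₂² ≤ 1 + δ`, if `t ∈ ℝ^n` is a uniformly random vector of Euclidean norm `√δ`
(i.e., distributed according to any rotation-invariant probability measure concentrated
on the sphere of radius `√δ`), then
`Pr[‖v − t‖₂² ≤ 1 − ε] ≥ (ε/(2√(δ(1+δ)))) ((1 − 2ε − ε²/δ)/(1+δ))^{n/2}`. -/
theorem random_vector_close (n : ℕ) (hn : 100 ≤ n) (ε δ : ℝ)
    (hε : ε ∈ Set.Ioo (0 : ℝ) (1 / 100)) (hδ : δ ∈ Set.Ioo (0 : ℝ) (1 / 100))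
    (hεδ : ε ≤ Real.sqrt δ / 10)
    (v : EuclideanSpace ℝ (Fin n)) (hv1 : 1 ≤ ‖v‖ ^ 2) (hv2 : ‖v‖ ^ 2 ≤ 1 + δ)
    (μ : Measure (EuclideanSpace ℝ (Fin n))) [IsProbabilityMeasure μ]
    (hsphere : μ (Metric.sphere (0 : EuclideanSpace ℝ (Fin n)) (Real.sqrt δ)) = 1)
    (hinv : ∀ g : EuclideanSpace ℝ (Fin n) ≃ₗᵢ[ℝ] EuclideanSpace ℝ (Fin n),
      μ.map g = μ) :
    ENNReal.ofReal (ε / (2 * Real.sqrt (δ * (1 + δ))) *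
        ((1 - 2 * ε - ε ^ 2 / δ) / (1 + δ)) ^ ((n : ℝ) / 2)) ≤
      μ {t | ‖v - t‖ ^ 2 ≤ 1 - ε} := by
  obtain ⟨hε0, hε1⟩ := hε
  obtain ⟨hδ0, hδ1⟩ := hδ
  obtain ⟨m, rfl⟩ : ∃ m, n = m + 1 := ⟨n - 1, by omega⟩
  have hm : 10 ≤ m := by omega
  have : Nonempty (Fin m) := ⟨⟨0, by omega⟩⟩
  set D : ℝ := √(δ * (1 + δ)) with hD
  have hD0 : 0 < D := Real.sqrt_pos.2 (by positivity)
  have hDsq : D ^ 2 = δ * (1 + δ) := Real.sq_sqrt (by positivity)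
  have hsδ : 0 < √δ := Real.sqrt_pos.2 hδ0
  have hsδ2 : √δ ^ 2 = δ := Real.sq_sqrt hδ0.le
  have hε2 : ε ^ 2 / δ ≤ 1 / 100 := by
    rw [div_le_iff₀ hδ0]
    nlinarith
  have hε2' : 0 ≤ ε ^ 2 / δ := by positivity
  set β : ℝ := (1 - 2 * ε - ε ^ 2 / δ) / (1 + δ) with hβ
  have hβ0 : 0 < β := div_pos (by linarith) (by linarith)
  have hβ1 : β ≤ 1 := by rw [hβ, div_le_one (by linarith)]; linarith
  set a : ℝ := (δ + ε / 2) / D with ha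
  set b : ℝ := (δ + ε) / D with hb
  have ha0 : 0 < a := by positivity
  have hbβ : b ^ 2 + β ≤ 1 := by
    apply le_of_eq
    rw [hb, hβ, div_pow, hDsq]
    field_simp
    ring
  have hba : b - a = ε / (2 * D) := by rw [ha, hb]; field_simp; ring
  have hslab := slab_le m a b β ha0.le hβ0.le hbβ
  have hv0 : v ≠ 0 := by rintro rfl; norm_num at hv1
  have hvn : 1 ≤ ‖v‖ := by nlinarith [norm_nonneg v]
  have hdc := double_count (m + 1) (a * √δ) (√δ) _ v
    (EuclideanSpace.single 0 (√δ)) hv0 (by simp [hsδ.le]) μ hsphere hinv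
    (hslab.trans (measure_mono (by
      rintro x ⟨hx1, hx2⟩
      refine ⟨hx1, ?_⟩
      rw [mem_closedBall_zero_iff] at hx1
      simp only [Set.mem_ofPred_eq, EuclideanSpace.inner_single_right] at hx2 ⊢
      simp only [conj_trivial]
      nlinarith [mul_le_mul_of_nonneg_left hx1 ha0.le])))
  have hsub : μ {t | a * √δ * ‖v‖ ≤ inner ℝ v t} ≤ μ {t | ‖v - t‖ ^ 2 ≤ 1 - ε} := by
    have hae : ∀ᵐ t ∂μ, t ∈ Metric.sphere (0 : EuclideanSpace ℝ (Fin (m + 1))) (√δ) :=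
      (prob_compl_eq_zero_iff Metric.isClosed_sphere.measurableSet).2 hsphere
    apply measure_mono_ae
    filter_upwards [hae] with t ht
    rw [mem_sphere_zero_iff_norm] at ht
    intro h
    change a * √δ * ‖v‖ ≤ inner ℝ v t at h
    change ‖v - t‖ ^ 2 ≤ 1 - ε
    rw [norm_sub_sq_real, ht, hsδ2]
    set R := √(1 + δ) with hR
    have hR0 : 0 < R := Real.sqrt_pos.2 (by linarith)
    have hR2 : R ^ 2 = 1 + δ := Real.sq_sqrt (by linarith)
    have hDR : D = √δ * R := by rw [hD, hR, Real.sqrt_mul hδ0.le]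
    have e : a * √δ = (δ + ε / 2) / R := by
      rw [ha, hDR]; field_simp
    have hvR : ‖v‖ ≤ R := Real.le_sqrt_of_sq_le hv2
    have key : ‖v‖ ^ 2 + δ - 1 + ε ≤ 2 * ((δ + ε / 2) / R * ‖v‖) := by
      rw [div_mul_eq_mul_div, mul_div_assoc', le_div_iff₀ hR0]
      nlinarith [mul_nonneg (sub_nonneg.2 hvR) (by nlinarith : 0 ≤ R * ‖v‖ - (δ + ε - 1))]
    rw [e] at h
    linarith
  rw [EuclideanSpace.volume_closedBall, EuclideanSpace.volume_closedBall] at hdc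
  simp only [Fintype.card_fin, ENNReal.ofReal_one, one_pow, one_mul] at hdc
  set c1 := √π ^ (m + 1) / Gamma (((m + 1 : ℕ) : ℝ) / 2 + 1) with hc1
  have hc1p : 0 < c1 := div_pos (by positivity) (Gamma_pos_of_pos (by positivity))
  have hc := ball_const_le m hm
  have hpow : β ^ (((m + 1 : ℕ) : ℝ) / 2) ≤ √β ^ m := by
    rw [Real.sqrt_eq_rpow, ← Real.rpow_natCast, ← Real.rpow_mul hβ0.le]
    apply Real.rpow_le_rpow_of_exponent_ge hβ0 hβ1
    push_cast
    linarith
  refine le_trans ?_ hsub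
  rw [← ENNReal.mul_le_mul_iff_left (c := ENNReal.ofReal c1) (by simpa using hc1p) (by simp)]
  refine le_trans ?_ hdc
  rw [← ENNReal.ofReal_pow (by positivity), hba, ← ENNReal.ofReal_mul (by positivity),
    ← ENNReal.ofReal_mul (by positivity), ← ENNReal.ofReal_mul (by positivity), mul_assoc]
  apply ENNReal.ofReal_le_ofReal
  gcongr
end

section
/- For any lattice L ⊂ ℝ^n with n ≥ 100, any ε, δ ∈ (0, 1/100) with ε ≤ √δ/10, any radius r > 0, and any target t ∈ ℝ^n, there exists a vector t' ∈ ℝ^n such that N₂(L, √(1−ε)·r, t') ≥ (ε / (2√(δ(1+δ)))) · ((1 − 2ε − ε²/δ)/(1+δ))^{n/2} · N₂(L, √(1+δ)·r, t). -/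
open Real BigOperators

/-- The lattice generated by the vectors `B 0, …, B (m-1)`:
the set of all integer linear combinations of the `B i`. -/
def latticeOf {E : Type*} [AddCommGroup E] [Module ℝ E] {m : ℕ} (B : Fin m → E) : Set E :=
  {y | ∃ c : Fin m → ℤ, y = ∑ i, c i • B i}

/-- `N₂(L, r, t)`: the number of lattice points `y ∈ L` with `‖y − t‖₂ ≤ r`. -/
noncomputable def N2count {n : ℕ} (L : Set (EuclideanSpace ℝ (Fin n))) (r : ℝ)
    (t : EuclideanSpace ℝ (Fin n)) : ℕ :=
  Nat.card {y : EuclideanSpace ℝ (Fin n) // y ∈ L ∧ ‖y - t‖ ≤ r}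

open MeasureTheory

lemma ball_const_le_s13 (k : ℕ) (hk : 99 ≤ k) :
    √π ^ (k+1) / Real.Gamma (((k+1 : ℕ):ℝ)/2+1) ≤ √π ^ k / Real.Gamma ((k:ℝ)/2+1) := by
  have hk' : (99:ℝ) ≤ k := by exact_mod_cast hk
  have h1 := Real.Gamma_mul_add_mul_le_rpow_Gamma_mul_rpow_Gamma (s := ((k:ℝ)+1)/2) (t := ((k:ℝ)+3)/2)
    (a := 1/2) (b := 1/2) (by positivity) (by positivity) (by norm_num) (by norm_num) (by norm_num)
  have e1 : (1/2:ℝ) * (((k:ℝ)+1)/2) + 1/2 * (((k:ℝ)+3)/2) = (k:ℝ)/2+1 := by ring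
  have e2 : (((k+1 : ℕ):ℝ)/2+1) = ((k:ℝ)+3)/2 := by push_cast; ring
  rw [e1, ← Real.sqrt_eq_rpow, ← Real.sqrt_eq_rpow] at h1
  rw [e2]
  have hg : Real.Gamma (((k:ℝ)+3)/2) = (((k:ℝ)+1)/2) * Real.Gamma (((k:ℝ)+1)/2) := by
    rw [← Real.Gamma_add_one (by positivity)]; congr 1; ring
  have p1 : 0 < Real.Gamma (((k:ℝ)+3)/2) := Real.Gamma_pos_of_pos (by positivity)
  have p2 : 0 < Real.Gamma (((k:ℝ)+1)/2) := Real.Gamma_pos_of_pos (by positivity)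
  have p3 : 0 < Real.Gamma ((k:ℝ)/2+1) := Real.Gamma_pos_of_pos (by positivity)
  have key : √π * Real.Gamma ((k:ℝ)/2+1) ≤ Real.Gamma (((k:ℝ)+3)/2) := by
    rw [← abs_of_pos p1]
    apply abs_le_of_sq_le_sq' _ p1.le |>.2 |>.trans (le_abs_self _)
    have h2 : Real.Gamma ((k:ℝ)/2+1)^2 ≤ Real.Gamma (((k:ℝ)+1)/2) * Real.Gamma (((k:ℝ)+3)/2) := by
      calc _ ≤ (√(Real.Gamma (((k:ℝ)+1)/2)) * √(Real.Gamma (((k:ℝ)+3)/2)))^2 := by gcongr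
        _ = _ := by rw [mul_pow, Real.sq_sqrt p2.le, Real.sq_sqrt p1.le]
    rw [mul_pow, Real.sq_sqrt Real.pi_pos.le]
    calc _ ≤ π * (Real.Gamma (((k:ℝ)+1)/2) * Real.Gamma (((k:ℝ)+3)/2)) := by gcongr
      _ ≤ (((k:ℝ)+1)/2) * (Real.Gamma (((k:ℝ)+1)/2) * Real.Gamma (((k:ℝ)+3)/2)) := by
        gcongr; linarith [Real.pi_lt_four]
      _ = _ := by rw [hg]; ring
  rw [div_le_div_iff₀ p1 p3, pow_succ]
  calc _ = √π^k * (√π * Real.Gamma ((k:ℝ)/2+1)) := by ring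
    _ ≤ _ := by gcongr

lemma exists_basis {k : ℕ} (e : EuclideanSpace ℝ (Fin (k+1))) (he : ‖e‖ = 1) :
    ∃ b : OrthonormalBasis (Fin (k+1)) ℝ (EuclideanSpace ℝ (Fin (k+1))), b 0 = e := by
  obtain ⟨b, hb⟩ := Orthonormal.exists_orthonormalBasis_extension_of_card_eq (𝕜 := ℝ)
    (E := EuclideanSpace ℝ (Fin (k+1))) (ι := Fin (k+1)) (by simp) (v := fun _ => e) (s := {0}) (by
      rw [orthonormal_iff_ite]
      rintro ⟨i, hi⟩ ⟨j, hj⟩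
      simp at hi hj
      subst hi; subst hj
      simp [he])
  exact ⟨b, hb 0 rfl⟩

noncomputable def Phi {k : ℕ} (b : OrthonormalBasis (Fin (k+1)) ℝ (EuclideanSpace ℝ (Fin (k+1))))
    (x : EuclideanSpace ℝ (Fin (k+1))) : ℝ × EuclideanSpace ℝ (Fin k) :=
  Prod.map id (WithLp.toLp 2) (MeasurableEquiv.piFinSuccAbove (fun _ => ℝ) 0 (WithLp.ofLp (b.repr x)))

lemma Phi_mp {k : ℕ} (b : OrthonormalBasis (Fin (k+1)) ℝ (EuclideanSpace ℝ (Fin (k+1)))) :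
    MeasurePreserving (Phi b) volume volume := by
  have h1 := b.measurePreserving_repr
  have h2 := (PiLp.volume_preserving_ofLp (Fin (k+1))).comp h1
  have h3 := (volume_preserving_piFinSuccAbove (fun _ : Fin (k+1) => ℝ) 0).comp h2
  have h4 := ((MeasurePreserving.id (volume : Measure ℝ)).prod (PiLp.volume_preserving_toLp (Fin k))).comp h3
  exact h4

lemma vol_cyl {k : ℕ} (e : EuclideanSpace ℝ (Fin (k+1))) (he : ‖e‖ = 1) (α β h : ℝ) :
    volume {x : EuclideanSpace ℝ (Fin (k+1)) | inner ℝ e x ∈ Set.Icc α β ∧ 0 ≤ h ∧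
      ‖x‖^2 - (inner ℝ e x)^2 ≤ h^2} = 
     ENNReal.ofReal (β - α) * volume (Metric.closedBall (0 : EuclideanSpace ℝ (Fin k)) h) := by
  obtain ⟨b, hb⟩ := exists_basis e he
  have := (Phi_mp b).measure_preimage
    (s := Set.Icc α β ×ˢ Metric.closedBall (0 : EuclideanSpace ℝ (Fin k)) h)
    (measurableSet_Icc.prod measurableSet_closedBall).nullMeasurableSet
  rw [Measure.volume_eq_prod, Measure.prod_prod, Real.volume_Icc] at this
  rw [← this]
  congr 1
  ext x
  have h1 : (Phi b x).1 = inner ℝ e x := by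
    rw [← hb, ← b.repr_apply_apply]; rfl
  have h2 : ‖x‖^2 = (Phi b x).1^2 + ‖(Phi b x).2‖^2 := by
    rw [← b.repr.norm_map x, EuclideanSpace.norm_sq_eq, EuclideanSpace.norm_sq_eq, Fin.sum_univ_succ]
    simp [Phi, MeasurableEquiv.piFinSuccAbove]
    rfl
  simp only [Set.mem_ofPred_eq, Set.mem_preimage, Set.mem_prod, h1, mem_closedBall_zero_iff]
  rw [h1] at h2
  rw [h2]
  refine and_congr_right fun _ => ?_
  rw [add_sub_cancel_left]
  constructor
  · rintro ⟨a, c⟩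
    exact abs_le_of_sq_le_sq' c a |>.2
  · intro c
    exact ⟨(norm_nonneg _).trans c, by gcongr⟩

lemma lattice_finite {n m : ℕ} (B : Fin m → EuclideanSpace ℝ (Fin n)) (hB : LinearIndependent ℝ B)
    (r : ℝ) (t : EuclideanSpace ℝ (Fin n)) :
    {y | (∃ c : Fin m → ℤ, y = ∑ i, c i • B i) ∧ ‖y - t‖ ≤ r}.Finite := by
  have hs := hB.linearIndepOn_id
  have hfin : Finite (hs.extend (Set.subset_univ _)) := Module.Finite.finite_basis (Module.Basis.extend hs)
  have := ZSpan.setFinite_inter (Module.Basis.extend hs) (s := Metric.closedBall t r) Metric.isBounded_closedBall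
  refine this.subset ?_
  rintro y ⟨⟨c, rfl⟩, hy⟩
  refine ⟨by simpa [dist_eq_norm] using hy, ?_⟩
  refine Submodule.sum_mem _ fun i _ => Submodule.smul_mem _ _ (Submodule.subset_span ?_)
  rw [Module.Basis.range_extend]
  exact hs.subset_extend _ ⟨i, rfl⟩

lemma exists_dir {k : ℕ} (z : EuclideanSpace ℝ (Fin (k+1))) :
    ∃ e : EuclideanSpace ℝ (Fin (k+1)), ‖e‖ = 1 ∧ z = ‖z‖ • e := by
  by_cases hz : z = 0
  · exact ⟨EuclideanSpace.single 0 1, by simp, by simp [hz]⟩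
  · have : ‖z‖ ≠ 0 := norm_ne_zero_iff.2 hz
    refine ⟨‖z‖⁻¹ • z, ?_, ?_⟩
    · rw [norm_smul, norm_inv, norm_norm, inv_mul_cancel₀ this]
    · rw [smul_smul, mul_inv_cancel₀ this, one_smul]

lemma q_bounds {ε δ : ℝ} (hε : ε ∈ Set.Ioo (0 : ℝ) (1 / 100)) (hδ : δ ∈ Set.Ioo (0 : ℝ) (1 / 100))
    (hεδ : ε ≤ Real.sqrt δ / 10) :
    0 < (1 - 2 * ε - ε ^ 2 / δ) / (1 + δ) ∧ (1 - 2 * ε - ε ^ 2 / δ) / (1 + δ) ≤ 1 := by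
  obtain ⟨h1, h2⟩ := hε
  obtain ⟨h3, h4⟩ := hδ
  have h5 : ε ^ 2 / δ ≤ 1 / 100 := by
    rw [div_le_iff₀ h3]
    calc ε ^ 2 ≤ (√δ / 10) ^ 2 := by gcongr
      _ = _ := by rw [div_pow, Real.sq_sqrt h3.le]; ring
  have h6 : 0 ≤ ε ^ 2 / δ := by positivity
  constructor
  · apply div_pos <;> linarith
  · rw [div_le_one (by linarith)]; linarith

lemma prob_bound {k : ℕ} (hk : 99 ≤ k)
    (ε δ : ℝ) (hε : ε ∈ Set.Ioo (0 : ℝ) (1 / 100)) (hδ : δ ∈ Set.Ioo (0 : ℝ) (1 / 100))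
    (hεδ : ε ≤ Real.sqrt δ / 10) (r : ℝ) (hr : 0 < r) (z : EuclideanSpace ℝ (Fin (k+1)))
    (hz : ‖z‖ ≤ √(1 + δ) * r) :
    ε / (2 * Real.sqrt (δ * (1 + δ))) *
          ((1 - 2 * ε - ε ^ 2 / δ) / (1 + δ)) ^ (((k+1 : ℕ) : ℝ) / 2) *
        volume.real (Metric.closedBall (0 : EuclideanSpace ℝ (Fin (k+1))) (√δ * r)) ≤
      volume.real (Metric.closedBall (0 : EuclideanSpace ℝ (Fin (k+1))) (√δ * r) ∩
        Metric.closedBall z (√(1 - ε) * r)) := by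
  obtain ⟨hq0, hq1⟩ := q_bounds hε hδ hεδ
  obtain ⟨e, he, hze⟩ := exists_dir z
  obtain ⟨h1, h2⟩ := hε
  obtain ⟨h3, h4⟩ := hδ
  set q := (1 - 2 * ε - ε ^ 2 / δ) / (1 + δ) with hq
  have hw : 0 < √(1 + δ) := Real.sqrt_pos.2 (by linarith)
  have hw2 : √(1 + δ) ^ 2 = 1 + δ := Real.sq_sqrt (by linarith)
  have hd : 0 < √δ := Real.sqrt_pos.2 h3
  have hd2 : √δ ^ 2 = δ := Real.sq_sqrt h3.le
  have hsq : √q ^ 2 = q := Real.sq_sqrt hq0.le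
  have hsq0 : 0 < √q := Real.sqrt_pos.2 hq0
  have hsq1 : √q ≤ 1 := Real.sqrt_le_one.2 hq1
  have hV := vol_cyl e he ((δ + ε / 2) / √(1 + δ) * r) ((δ + ε) / √(1 + δ) * r) (√δ * √q * r)
  have hsub : {x : EuclideanSpace ℝ (Fin (k+1)) |
      inner ℝ e x ∈ Set.Icc ((δ + ε / 2) / √(1 + δ) * r) ((δ + ε) / √(1 + δ) * r) ∧
        0 ≤ √δ * √q * r ∧ ‖x‖^2 - (inner ℝ e x)^2 ≤ (√δ * √q * r)^2} ⊆
      Metric.closedBall (0 : EuclideanSpace ℝ (Fin (k+1))) (√δ * r) ∩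
        Metric.closedBall z (√(1 - ε) * r) := by
    rintro x ⟨⟨ha, hb⟩, -, hx⟩
    set u : ℝ := inner ℝ e x with hu
    have hu0 : 0 ≤ u := le_trans (by positivity) ha
    have hu2 : u ^ 2 ≤ ((δ + ε) / √(1 + δ) * r) ^ 2 := by gcongr
    have hxn : ‖x‖ ^ 2 ≤ δ * r ^ 2 := by
      have : (√δ * √q * r)^2 + ((δ + ε) / √(1 + δ) * r) ^ 2 = δ * r ^ 2 := by
        rw [mul_pow, mul_pow, mul_pow, div_pow, hd2, hsq, hw2, hq]
        field_simp
        ring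
      linarith
    constructor
    · rw [mem_closedBall_zero_iff]
      refine (abs_le_of_sq_le_sq' ?_ (by positivity)).2
      rw [mul_pow, hd2]; exact hxn
    · rw [Metric.mem_closedBall, dist_eq_norm]
      refine (abs_le_of_sq_le_sq' ?_ (by positivity)).2
      rw [mul_pow, Real.sq_sqrt (by linarith), norm_sub_sq_real]
      have hin : inner ℝ x z = ‖z‖ * u := by
        conv_lhs => rw [hze]
        rw [inner_smul_right, real_inner_comm]
      rw [hin]
      set a := ‖z‖
      have ha0 : 0 ≤ a := norm_nonneg _
      have e1 : a * a ≤ a * (√(1 + δ) * r) := by gcongr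
      have e2 : a * ((δ + ε / 2) / √(1 + δ) * r) ≤ a * u := by gcongr
      have e3 : √(1 + δ) * r - 2 * ((δ + ε / 2) / √(1 + δ) * r) = (1 - δ - ε) / √(1 + δ) * r := by
        field_simp
        rw [hw2]; ring
      have e4 : 0 ≤ (1 - δ - ε) / √(1 + δ) * r :=
        mul_nonneg (div_nonneg (by linarith) hw.le) hr.le
      have e5 : a * ((1 - δ - ε) / √(1 + δ) * r) ≤
        (√(1 + δ) * r) * ((1 - δ - ε) / √(1 + δ) * r) := by gcongr
      have e6 : (√(1 + δ) * r) * ((1 - δ - ε) / √(1 + δ) * r) = (1 - δ - ε) * r ^ 2 := by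
        field_simp
      rw [← e3] at e5
      rw [← e3] at e6
      nlinarith
  have hfin : volume (Metric.closedBall (0 : EuclideanSpace ℝ (Fin (k+1))) (√δ * r) ∩
        Metric.closedBall z (√(1 - ε) * r)) ≠ ⊤ :=
    measure_ne_top_of_subset Set.inter_subset_left measure_closedBall_lt_top.ne
  refine le_trans ?_ (measureReal_mono hsub hfin)
  haveI : Nonempty (Fin k) := ⟨⟨0, by omega⟩⟩
  have hg1 : 0 < Real.Gamma ((k : ℝ) / 2 + 1) := Real.Gamma_pos_of_pos (by positivity)
  have hg2 : 0 < Real.Gamma (((k + 1 : ℕ) : ℝ) / 2 + 1) := Real.Gamma_pos_of_pos (by positivity)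
  have hc := ball_const_le_s13 k hk
  rw [measureReal_def, measureReal_def, hV, EuclideanSpace.volume_closedBall,
    EuclideanSpace.volume_closedBall]
  simp only [ENNReal.toReal_mul, ENNReal.toReal_pow, Fintype.card_fin]
  have hwid : (δ + ε) / √(1 + δ) * r - (δ + ε / 2) / √(1 + δ) * r = ε / (2 * √(1 + δ)) * r := by
    field_simp; ring
  rw [hwid, ENNReal.toReal_ofReal (by positivity), ENNReal.toReal_ofReal (by positivity),
    ENNReal.toReal_ofReal (by positivity), ENNReal.toReal_ofReal (by positivity),
    ENNReal.toReal_ofReal (by positivity)]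
  have hqp : q ^ (((k + 1 : ℕ) : ℝ) / 2) = √q ^ (k + 1) := by
    rw [Real.sqrt_eq_rpow, ← Real.rpow_natCast, ← Real.rpow_mul hq0.le]
    congr 1; ring
  rw [hqp, Real.sqrt_mul h3.le]
  generalize hA : √π ^ (k + 1) / Real.Gamma (((k + 1 : ℕ) : ℝ) / 2 + 1) = c1 at *
  generalize hB : √π ^ k / Real.Gamma ((k : ℝ) / 2 + 1) = c0 at *
  have hc1 : 0 ≤ c1 := by rw [← hA]; positivity
  have hfac : √q * c1 ≤ c0 := le_trans (mul_le_of_le_one_left hc1 hsq1) hc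
  calc _ = ε / (2 * √(1 + δ)) * r * ((√δ * √q * r) ^ k * (√q * c1)) := by
        rw [mul_pow, mul_pow, mul_pow, pow_succ, pow_succ, pow_succ]
        field_simp
    _ ≤ _ := by gcongr

lemma main_avg {k m : ℕ} (hk : 99 ≤ k)
    (B : Fin m → EuclideanSpace ℝ (Fin (k+1))) (hB : LinearIndependent ℝ B)
    (ρ R s p : ℝ) (hs : 0 < s) (t : EuclideanSpace ℝ (Fin (k+1)))
    (hp : ∀ z : EuclideanSpace ℝ (Fin (k+1)), ‖z‖ ≤ R →
      p * volume.real (Metric.closedBall (0 : EuclideanSpace ℝ (Fin (k+1))) s) ≤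
      volume.real (Metric.closedBall (0 : EuclideanSpace ℝ (Fin (k+1))) s ∩
        Metric.closedBall z ρ)) :
    ∃ t' : EuclideanSpace ℝ (Fin (k+1)),
      p * (N2count (latticeOf B) R t : ℝ) ≤ (N2count (latticeOf B) ρ t' : ℝ) := by
  classical
  have hcount : ∀ (R : ℝ) (t : EuclideanSpace ℝ (Fin (k+1))),
      N2count (latticeOf B) R t = (lattice_finite B hB R t).toFinset.card := by
    intro R t
    rw [← Set.ncard_eq_toFinset_card _ (lattice_finite B hB R t)]
    rfl
  set S := Metric.closedBall (0 : EuclideanSpace ℝ (Fin (k+1))) s with hS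
  set F := (lattice_finite B hB R t).toFinset with hF
  let f : EuclideanSpace ℝ (Fin (k+1)) → ℝ := fun x =>
    ∑ y ∈ F, (Metric.closedBall (y - t) ρ).indicator (fun _ => (1 : ℝ)) x
  have hS0 : volume S ≠ 0 := (Metric.measure_closedBall_pos _ _ hs).ne'
  have hST : volume S ≠ ⊤ := measure_closedBall_lt_top.ne
  have hInteg : ∀ y ∈ F, IntegrableOn
      ((Metric.closedBall (y - t) ρ).indicator (fun _ => (1 : ℝ))) S volume := by
    intro y _
    exact (integrableOn_const hST).indicator measurableSet_closedBall
  have hf : IntegrableOn f S volume := integrable_finsetSum _ hInteg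
  obtain ⟨x, hxS, hx⟩ := exists_setAverage_le hS0 hST hf
  refine ⟨t + x, ?_⟩
  have hVpos : 0 < volume.real S := ENNReal.toReal_pos hS0 hST
  have hI : ∫ a in S, f a = ∑ y ∈ F, volume.real (S ∩ Metric.closedBall (y - t) ρ) := by
    rw [integral_finsetSum _ hInteg]
    refine Finset.sum_congr rfl fun y _ => ?_
    rw [setIntegral_indicator measurableSet_closedBall]
    simp
  have hlow : (F.card : ℝ) * (p * volume.real S) ≤ ∫ a in S, f a := by
    rw [hI, ← nsmul_eq_mul]
    refine Finset.card_nsmul_le_sum _ _ _ fun y hy => hp _ ?_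
    rw [hF, Set.Finite.mem_toFinset] at hy
    exact hy.2
  have havg : p * F.card ≤ f x := by
    refine le_trans ?_ hx
    rw [setAverage_eq, smul_eq_mul, inv_mul_eq_div, le_div_iff₀ hVpos]
    linarith
  rw [hcount, hcount]
  refine havg.trans ?_
  have hfx : f x = ((F.filter fun y => x ∈ Metric.closedBall (y - t) ρ).card : ℝ) := by
    simp only [f, Set.indicator_apply]
    rw [Finset.sum_boole]
  rw [hfx]
  norm_cast
  apply Finset.card_le_card
  intro y hy
  rw [Finset.mem_filter, hF, Set.Finite.mem_toFinset] at hy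
  rw [Set.Finite.mem_toFinset]
  refine ⟨hy.1.1, ?_⟩
  have := hy.2
  rw [Metric.mem_closedBall, dist_comm, dist_eq_norm] at this
  rwa [← sub_sub]

/-- For any lattice `L ⊂ ℝ^n` with `n ≥ 100`, any `ε, δ ∈ (0, 1/100)` with
`ε ≤ √δ/10`, radius `r > 0` and target `t ∈ ℝ^n`, there exists `t' ∈ ℝ^n` such that
`N₂(L, √(1−ε) r, t') ≥ (ε/(2√(δ(1+δ)))) ((1−2ε−ε²/δ)/(1+δ))^{n/2} N₂(L, √(1+δ) r, t)`. -/
theorem kissing_gives_local_density (n m : ℕ) (hn : 100 ≤ n)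
    (B : Fin m → EuclideanSpace ℝ (Fin n)) (hB : LinearIndependent ℝ B)
    (ε δ : ℝ) (hε : ε ∈ Set.Ioo (0 : ℝ) (1 / 100)) (hδ : δ ∈ Set.Ioo (0 : ℝ) (1 / 100))
    (hεδ : ε ≤ Real.sqrt δ / 10) (r : ℝ) (hr : 0 < r) (t : EuclideanSpace ℝ (Fin n)) :
    ∃ t' : EuclideanSpace ℝ (Fin n),
      ε / (2 * Real.sqrt (δ * (1 + δ))) *
          ((1 - 2 * ε - ε ^ 2 / δ) / (1 + δ)) ^ ((n : ℝ) / 2) *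
          (N2count (latticeOf B) (Real.sqrt (1 + δ) * r) t : ℝ) ≤
        (N2count (latticeOf B) (Real.sqrt (1 - ε) * r) t' : ℝ) := by
  obtain ⟨k, rfl⟩ : ∃ k, n = k + 1 := ⟨n - 1, by omega⟩
  have hk : 99 ≤ k := by omega
  exact main_avg hk B hB _ _ (√δ * r) _ (mul_pos (Real.sqrt_pos.2 hδ.1) hr) t
    fun z hz => prob_bound hk ε δ hε hδ hεδ r hr z hz
end
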